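/- Let m ≥ 0, c ∈ ℝ, and x > 0. Then (1/π) · ∫_{a=0}^{x} c·a^{m}·(x − a)^{−1/2} da = (c·Γ(m + 1) / (√π·Γ(m + 3/2))) · x^{m + 1/2}, where Γ is the real Gamma function. (Example I of Abel's 1826 paper: for a body whose descent time to the bottom is proportional to the m-th power of the initial height, the arclength of the curve is proportional to x^{m+1/2}.) -/

import Mathlib

/-- The Euler beta integral over `[0, x]`, for real exponents. -/
theorem integral_rpow_mul_sub_rpow {s t x : ℝ} (hs : 0 < s) (ht : 0 < t) (hx : 0 < x) :
    ∫ a in (0 : ℝ)..x, a ^ (s - 1) * (x - a) ^ (t - 1) =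
      x ^ (s + t - 1) * (Real.Gamma s * Real.Gamma t / Real.Gamma (s + t)) := by
  have h := Complex.betaIntegral_scaled s t hx
  rw [Complex.betaIntegral_eq_Gamma_mul_div _ _ (by simpa using hs) (by simpa using ht)] at h
  rw [← Complex.ofReal_inj, ← intervalIntegral.integral_ofReal]
  push_cast [Complex.ofReal_cpow hx.le, ← Complex.Gamma_ofReal]
  rw [← h]
  refine intervalIntegral.integral_congr fun a ha => ?_
  rw [Set.uIcc_of_le hx.le] at ha
  push_cast [Complex.ofReal_cpow ha.1, Complex.ofReal_cpow (sub_nonneg.2 ha.2)]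
  rfl

/-- Example I of Abel's 1826 paper: for descent time proportional to the m-th power
of the initial height, the arclength is proportional to x^{m+1/2}. -/
theorem abel_example_I_1826
    (m c x : ℝ) (hm : 0 ≤ m) (hx : 0 < x) :
    (1 / Real.pi) * (∫ a in (0 : ℝ)..x, c * a ^ m * (x - a) ^ (-(1 / 2) : ℝ))
      = (c * Real.Gamma (m + 1) / (Real.sqrt Real.pi * Real.Gamma (m + 3 / 2))) *
          x ^ (m + 1 / 2) := by
  have h := integral_rpow_mul_sub_rpow (s := m + 1) (t := 1 / 2) (by linarith) (by norm_num) hx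
  rw [show m + 1 - 1 = m by ring, show (1 / 2 - 1 : ℝ) = -(1 / 2) by norm_num,
    show m + 1 + 1 / 2 - 1 = m + 1 / 2 by ring, show m + 1 + 1 / 2 = m + 3 / 2 by ring,
    Real.Gamma_one_half_eq] at h
  simp_rw [mul_assoc c]
  rw [intervalIntegral.integral_const_mul, h]
  have hG : Real.Gamma (m + 3 / 2) ≠ 0 := (Real.Gamma_pos_of_pos (by linarith)).ne'
  have hp : √Real.pi ≠ 0 := (Real.sqrt_pos.2 Real.pi_pos).ne'
  have hsq : √Real.pi ^ 2 = Real.pi := Real.sq_sqrt Real.pi_pos.le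
  have hpi : Real.pi ≠ 0 := Real.pi_ne_zero
  field_simp
  rw [hsq, mul_comm]
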